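/- Let α, β > −1 be real and let f: [0,∞) → ℝ be completely monotone, i.e. f is continuous on [0,∞), infinitely differentiable on (0,∞), and (−1)^n f^{(n)}(u) ≥ 0 for all u > 0 and all integers n ≥ 0. Then for every integer n ≥ 0, ∫_0^{π/2} f(sin²θ) · P_n^{(α,β)}(cos(2θ)) dν^{(α,β)}(θ) ≥ 0; i.e. all Jacobi expansion coefficients of the function g defined by g(1−2u) = f(u) are nonnegative. -/

import Mathlib

open MeasureTheory Finset Real

/-- The Pochhammer symbol `(x)_n = x (x+1) ⋯ (x+n-1)`. -/
noncomputable def poch (x : ℝ) (n : ℕ) : ℝ := (ascPochhammer ℝ n).eval x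

/-- The Jacobi polynomial `P_n^{(α,β)}`, via its standard explicit expansion
(equivalent to Rodrigues' formula). -/
noncomputable def jacobiP (α β : ℝ) (n : ℕ) (t : ℝ) : ℝ :=
  ∑ k ∈ Finset.range (n + 1),
    poch (α + k + 1) (n - k) / ((n - k).factorial : ℝ) *
      (poch (β + (n - k) + 1) k / (k.factorial : ℝ)) *
      ((t - 1) / 2) ^ k * ((t + 1) / 2) ^ (n - k)

/-- The probability measure `ν^{(α,β)}` on `[0, π/2]` with density
`γ_{α,β}⁻¹ sin(θ)^{2α+1} cos(θ)^{2β+1}`, where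
`γ_{α,β} = Γ(α+1)Γ(β+1)/(2Γ(α+β+2))`. -/
noncomputable def nuMeasure (α β : ℝ) : Measure ℝ :=
  (volume.restrict (Set.Ioo 0 (π / 2))).withDensity fun θ =>
    ENNReal.ofReal (2 * Real.Gamma (α + β + 2) / (Real.Gamma (α + 1) * Real.Gamma (β + 1)) *
      Real.sin θ ^ (2 * α + 1) * Real.cos θ ^ (2 * β + 1))

lemma poch_succ_left (x : ℝ) (n : ℕ) : poch x (n + 1) = x * poch (x + 1) n := by
  simp [poch, ascPochhammer_succ_left, Polynomial.eval_comp]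

/-- The coefficient of `((t - 1) / 2) ^ k * ((t + 1) / 2) ^ (n - k)` in `P_n^{(α,β)}(t)`. -/
noncomputable def jacobiCoeff (α β : ℝ) (n k : ℕ) : ℝ :=
  poch (α + k + 1) (n - k) / ((n - k).factorial : ℝ) *
    (poch (β + ((n : ℝ) - k) + 1) k / (k.factorial : ℝ))

lemma jacobiP_one_sub_two_mul (α β : ℝ) (n : ℕ) (u : ℝ) :
    jacobiP α β n (1 - 2 * u) =
      ∑ k ∈ range (n + 1), jacobiCoeff α β n k * (-u) ^ k * (1 - u) ^ (n - k) := by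
  refine sum_congr rfl fun k _ => ?_
  rw [show (1 - 2 * u - 1) / 2 = -u by ring, show (1 - 2 * u + 1) / 2 = 1 - u by ring, jacobiCoeff]

lemma continuous_jacobiP (α β : ℝ) (n : ℕ) : Continuous (jacobiP α β n) := by
  unfold jacobiP
  fun_prop

lemma mul_jacobiCoeff_left (α β : ℝ) {n k : ℕ} (hk : k ≤ n) :
    (k + α + 1) * jacobiCoeff (α + 1) (β + 1) n k =
      (n + 1 - k) * jacobiCoeff α β (n + 1) k := by
  obtain ⟨j, rfl⟩ := Nat.exists_eq_add_of_le hk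
  have h1 : k + j - k = j := by omega
  have h2 : k + j + 1 - k = j + 1 := by omega
  have h3 : ((j.factorial : ℕ) : ℝ) ≠ 0 := by positivity
  have h4 : ((k.factorial : ℕ) : ℝ) ≠ 0 := by positivity
  have h5 : (j : ℝ) + 1 ≠ 0 := by positivity
  rw [jacobiCoeff, jacobiCoeff, h1, h2, poch_succ_left, Nat.factorial_succ]
  push_cast
  rw [show α + k + 1 + 1 = α + 1 + k + 1 by ring,
    show β + ((k : ℝ) + j + 1 - k) + 1 = β + 1 + (k + j - k) + 1 by ring]
  field_simp
  ring

lemma mul_jacobiCoeff_right (α β : ℝ) {n k : ℕ} (hk : k ≤ n) :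
    (n - k + β + 1) * jacobiCoeff (α + 1) (β + 1) n k =
      (k + 1) * jacobiCoeff α β (n + 1) (k + 1) := by
  have h1 : n + 1 - (k + 1) = n - k := by omega
  have h3 : (((n - k).factorial : ℕ) : ℝ) ≠ 0 := by positivity
  have h4 : ((k.factorial : ℕ) : ℝ) ≠ 0 := by positivity
  have h5 : (k : ℝ) + 1 ≠ 0 := by positivity
  rw [jacobiCoeff, jacobiCoeff, h1, poch_succ_left, Nat.factorial_succ]
  push_cast
  rw [show α + (k + 1) + 1 = α + 1 + k + 1 by ring,
    show β + ((n : ℝ) + 1 - (k + 1)) + 1 + 1 = β + 1 + (n - k) + 1 by ring]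
  field_simp
  ring

/-- The Jacobi polynomial in the variable `u = (1 - t) / 2`, times its weight. -/
noncomputable def jacobiWeighted (α β : ℝ) (n : ℕ) (u : ℝ) : ℝ :=
  jacobiP α β n (1 - 2 * u) * (u ^ α * (1 - u) ^ β)

lemma jacobiWeighted_eq_sum (α β : ℝ) (n : ℕ) {u : ℝ} (hu : u ∈ Set.Ioo (0 : ℝ) 1) :
    jacobiWeighted α β n u = ∑ k ∈ range (n + 1),
      (-1) ^ k * jacobiCoeff α β n k * (u ^ (k + α) * (1 - u) ^ (n - k + β)) := by
  have h0 : 0 < u := hu.1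
  have h1 : 0 < 1 - u := sub_pos.2 hu.2
  rw [jacobiWeighted, jacobiP_one_sub_two_mul, sum_mul]
  refine sum_congr rfl fun k hk => ?_
  have hk' : k ≤ n := Nat.lt_succ_iff.1 (mem_range.1 hk)
  rw [rpow_add h0, rpow_add h1, rpow_natCast, ← Nat.cast_sub hk', rpow_natCast, neg_pow]
  ring

/-- The differentiated form of Rodrigues' formula. -/
lemma hasDerivAt_jacobiWeighted (α β : ℝ) (n : ℕ) {u : ℝ} (hu : u ∈ Set.Ioo (0 : ℝ) 1) :
    HasDerivAt (jacobiWeighted (α + 1) (β + 1) n)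
      ((n + 1) * jacobiWeighted α β (n + 1) u) u := by
  have h0 : 0 < u := hu.1
  have h1 : 0 < 1 - u := sub_pos.2 hu.2
  have hterm : ∀ k ∈ range (n + 1), HasDerivAt
      (fun u : ℝ => (-1) ^ k * jacobiCoeff (α + 1) (β + 1) n k *
        (u ^ (k + (α + 1)) * (1 - u) ^ (n - k + (β + 1))))
      ((n + 1 - k) * ((-1) ^ k * jacobiCoeff α β (n + 1) k *
          (u ^ (k + α) * (1 - u) ^ (n + 1 - k + β))) +
        (k + 1) * ((-1) ^ (k + 1) * jacobiCoeff α β (n + 1) (k + 1) *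
          (u ^ (k + 1 + α) * (1 - u) ^ (n - k + β)))) u := by
    intro k hk
    have hk' : k ≤ n := Nat.lt_succ_iff.1 (mem_range.1 hk)
    have hl := (hasDerivAt_id u).rpow_const (p := k + (α + 1)) (Or.inl h0.ne')
    have hr := ((hasDerivAt_id u).const_sub 1).rpow_const (p := n - k + (β + 1)) (Or.inl h1.ne')
    refine ((hl.mul hr).const_mul ((-1) ^ k * jacobiCoeff (α + 1) (β + 1) n k)).congr_deriv ?_
    have hL := mul_jacobiCoeff_left α β hk'
    have hR := mul_jacobiCoeff_right α β hk'
    simp only [id]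
    rw [show (k : ℝ) + (α + 1) - 1 = k + α by ring,
      show (n : ℝ) - k + (β + 1) - 1 = n - k + β by ring,
      show (n : ℝ) - k + (β + 1) = n + 1 - k + β by ring,
      show (k : ℝ) + (α + 1) = k + 1 + α by ring, pow_succ]
    linear_combination (-1) ^ k * u ^ (k + α) * (1 - u) ^ (n + 1 - k + β) * hL -
      (-1) ^ k * u ^ (k + 1 + α) * (1 - u) ^ (n - k + β) * hR
  have hsum := HasDerivAt.fun_sum hterm
  refine (hsum.congr_deriv ?_).congr_of_eventuallyEq ?_
  · rw [sum_add_distrib, jacobiWeighted_eq_sum α β (n + 1) hu, mul_sum]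
    have hsplit : ∀ k ∈ range (n + 1 + 1),
        ((n : ℝ) + 1) * ((-1) ^ k * jacobiCoeff α β (n + 1) k *
          (u ^ (k + α) * (1 - u) ^ (((n + 1 : ℕ) : ℝ) - k + β))) =
        (n + 1 - k) * ((-1) ^ k * jacobiCoeff α β (n + 1) k *
          (u ^ (k + α) * (1 - u) ^ (n + 1 - k + β))) +
        k * ((-1) ^ k * jacobiCoeff α β (n + 1) k *
          (u ^ (k + α) * (1 - u) ^ (n + 1 - k + β))) := by
      intro k _
      push_cast
      ring
    rw [sum_congr rfl hsplit, sum_add_distrib, sum_range_succ _ (n + 1),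
      sum_range_succ' (fun k : ℕ => (k : ℝ) * ((-1) ^ k * jacobiCoeff α β (n + 1) k *
          (u ^ (k + α) * (1 - u) ^ (n + 1 - k + β)))) (n + 1)]
    push_cast
    simp only [sub_self, zero_mul, add_zero, add_sub_add_right_eq_sub]
  · filter_upwards [Ioo_mem_nhds hu.1 hu.2] with v hv
    exact jacobiWeighted_eq_sum _ _ _ hv

lemma continuous_jacobiWeighted {α β : ℝ} (hα : 0 ≤ α) (hβ : 0 ≤ β) (n : ℕ) :
    Continuous (jacobiWeighted α β n) := by
  have h1 : Continuous fun u : ℝ => u ^ α := continuous_id.rpow_const fun _ => Or.inr hα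
  have h2 : Continuous fun u : ℝ => (1 - u) ^ β :=
    (continuous_const.sub continuous_id).rpow_const fun _ => Or.inr hβ
  exact ((continuous_jacobiP α β n).comp (by fun_prop)).mul (h1.mul h2)

lemma intervalIntegrable_rpow_mul_one_sub_rpow {α β : ℝ} (hα : -1 < α) (hβ : -1 < β) :
    IntervalIntegrable (fun u : ℝ => u ^ α * (1 - u) ^ β) volume 0 1 := by
  have h := (Complex.betaIntegral_convergent (u := (α + 1 : ℝ)) (v := (β + 1 : ℝ))
    (by simpa using by linarith) (by simpa using by linarith)).norm
  rw [intervalIntegrable_iff_integrableOn_Ioo_of_le zero_le_one] at h ⊢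
  refine h.congr_fun (fun u hu => ?_) measurableSet_Ioo
  have h1 : 0 < 1 - u := sub_pos.2 hu.2
  have h2 : (1 - (u : ℂ)) = ((1 - u : ℝ) : ℂ) := by push_cast; rfl
  dsimp only
  rw [norm_mul, h2, Complex.norm_cpow_eq_rpow_re_of_pos hu.1,
    Complex.norm_cpow_eq_rpow_re_of_pos h1]
  simp

lemma intervalIntegrable_jacobiWeighted {α β : ℝ} (hα : -1 < α) (hβ : -1 < β) (n : ℕ) :
    IntervalIntegrable (jacobiWeighted α β n) volume 0 1 :=
  (intervalIntegrable_rpow_mul_one_sub_rpow hα hβ).continuousOn_mul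
    ((continuous_jacobiP α β n).comp (by fun_prop)).continuousOn

/-- Nonnegativity of Jacobi coefficients of a function completely monotone up to the endpoints,
given with the sequence `g j = (-1) ^ j * g^{(j)}` of its signed derivatives. -/
lemma integral_mul_jacobiWeighted_nonneg (n : ℕ) {α β : ℝ} (hα : -1 < α) (hβ : -1 < β)
    (g : ℕ → ℝ → ℝ) (hg : ∀ j, ∀ u ∈ Set.Icc (0 : ℝ) 1, HasDerivAt (g j) (-g (j + 1) u) u)
    (hpos : ∀ j, ∀ u ∈ Set.Icc (0 : ℝ) 1, 0 ≤ g j u) :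
    0 ≤ ∫ u in (0 : ℝ)..1, g 0 u * jacobiWeighted α β n u := by
  induction n generalizing α β g with
  | zero =>
    refine intervalIntegral.integral_nonneg zero_le_one fun u hu => ?_
    have h1 : 0 ≤ 1 - u := sub_nonneg.2 hu.2
    have hP : jacobiP α β 0 (1 - 2 * u) = 1 := by simp [jacobiP, poch]
    rw [jacobiWeighted, hP]
    exact mul_nonneg (hpos 0 u hu)
      (mul_nonneg zero_le_one (mul_nonneg (rpow_nonneg hu.1 _) (rpow_nonneg h1 _)))
  | succ n ih =>
    have hα' : 0 < α + 1 := by linarith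
    have hβ' : 0 < β + 1 := by linarith
    have hI : Set.uIcc (0 : ℝ) 1 = Set.Icc 0 1 := Set.uIcc_of_le zero_le_one
    have hc : ∀ j, ContinuousOn (g j) (Set.uIcc 0 1) := fun j u hu =>
      (hg j u (hI ▸ hu)).continuousAt.continuousWithinAt
    have key := intervalIntegral.integral_mul_deriv_eq_deriv_mul_of_hasDerivAt
      (a := (0 : ℝ)) (b := 1) (u := g 0) (u' := fun u => -g 1 u)
      (v := jacobiWeighted (α + 1) (β + 1) n)
      (v' := fun u => ((n : ℝ) + 1) * jacobiWeighted α β (n + 1) u) (hc 0)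
      (continuous_jacobiWeighted hα'.le hβ'.le n).continuousOn
      (fun u hu => hg 0 u (Set.Ioo_subset_Icc_self (by simpa using hu)))
      (fun u hu => hasDerivAt_jacobiWeighted α β n (by simpa using hu))
      (hc 1).neg.intervalIntegrable
      ((intervalIntegrable_jacobiWeighted hα hβ (n + 1)).const_mul _)
    have h0 : jacobiWeighted (α + 1) (β + 1) n 0 = 0 := by
      simp [jacobiWeighted, zero_rpow hα'.ne']
    have h1 : jacobiWeighted (α + 1) (β + 1) n 1 = 0 := by
      simp [jacobiWeighted, zero_rpow hβ'.ne']
    have hnext := ih (α := α + 1) (β := β + 1) (by linarith) (by linarith)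
      (fun j => g (j + 1)) (fun j => hg (j + 1)) (fun j => hpos (j + 1))
    simp only [h0, h1, mul_zero, sub_zero, zero_sub, neg_mul, intervalIntegral.integral_neg,
      neg_neg, mul_left_comm _ ((n : ℝ) + 1), intervalIntegral.integral_const_mul] at key
    have hn : (0 : ℝ) < n + 1 := by positivity
    exact nonneg_of_mul_nonneg_right (key ▸ hnext) hn

lemma integral_completelyMonotone_mul_jacobiWeighted_nonneg {α β : ℝ} (hα : -1 < α) (hβ : -1 < β)
    {f : ℝ → ℝ} (hcont : ContinuousOn f (Set.Ici 0))
    (hsmooth : ContDiffOn ℝ (⊤ : ℕ∞) f (Set.Ioi 0))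
    (hsign : ∀ (n : ℕ) (u : ℝ), 0 < u →
      0 ≤ (-1) ^ n * iteratedDerivWithin n f (Set.Ioi 0) u) (n : ℕ) :
    0 ≤ ∫ u in Set.Ioo (0 : ℝ) 1, f u * jacobiWeighted α β n u := by
  have hshift : ∀ ε : ℝ, 0 < ε →
      0 ≤ ∫ u in Set.Ioo (0 : ℝ) 1, f (u + ε) * jacobiWeighted α β n u := by
    intro ε hε
    have h := integral_mul_jacobiWeighted_nonneg n hα hβ
      (fun j u => (-1) ^ j * iteratedDerivWithin j f (Set.Ioi 0) (u + ε)) ?_ ?_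
    · simpa [intervalIntegral.integral_of_le, integral_Ioc_eq_integral_Ioo] using h
    · intro j u hu
      have hu' : u + ε ∈ Set.Ioi (0 : ℝ) := add_pos_of_nonneg_of_pos hu.1 hε
      have hd := (hsmooth.differentiableOn_iteratedDerivWithin (m := j)
        (by exact_mod_cast WithTop.coe_lt_top j) (uniqueDiffOn_Ioi 0) _ hu').hasDerivWithinAt
      rw [← iteratedDerivWithin_succ] at hd
      refine (((hd.hasDerivAt (Ioi_mem_nhds hu')).comp_add_const u ε).const_mul
        ((-1) ^ j)).congr_deriv ?_
      ring
    · exact fun j u hu => hsign j _ (add_pos_of_nonneg_of_pos hu.1 hε)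
  have hW : IntegrableOn (jacobiWeighted α β n) (Set.Ioo 0 1) :=
    (intervalIntegrable_iff_integrableOn_Ioo_of_le zero_le_one).1
      (intervalIntegrable_jacobiWeighted hα hβ n)
  obtain ⟨C, hC⟩ := (isCompact_Icc (a := (0 : ℝ)) (b := 2)).exists_bound_of_continuousOn
    (hcont.mono Set.Icc_subset_Ici_self)
  have hε0 : ∀ j : ℕ, 0 < 1 / ((j : ℝ) + 1) := fun j => by positivity
  have hε1 : ∀ j : ℕ, 1 / ((j : ℝ) + 1) ≤ 1 := fun j =>
    (div_le_one (by positivity)).2 (by simp)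
  have hlim : Filter.Tendsto
      (fun j : ℕ => ∫ u in Set.Ioo (0 : ℝ) 1, f (u + 1 / ((j : ℝ) + 1)) * jacobiWeighted α β n u)
      Filter.atTop (nhds (∫ u in Set.Ioo (0 : ℝ) 1, f u * jacobiWeighted α β n u)) := by
    refine tendsto_integral_of_dominated_convergence
      (fun u => C * ‖jacobiWeighted α β n u‖) (fun j => ?_) (hW.norm.const_mul C)
      (fun j => ?_) ?_
    · refine AEStronglyMeasurable.mul (ContinuousOn.aestronglyMeasurable ?_ measurableSet_Ioo)
        hW.aestronglyMeasurable
      exact hcont.comp (by fun_prop) fun u hu => (add_pos hu.1 (hε0 j)).le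
    · filter_upwards [ae_restrict_mem measurableSet_Ioo] with u hu
      rw [norm_mul]
      exact mul_le_mul_of_nonneg_right
        (hC _ ⟨(add_pos hu.1 (hε0 j)).le, by linarith [hu.2, hε1 j]⟩) (norm_nonneg _)
    · filter_upwards [ae_restrict_mem measurableSet_Ioo] with u hu
      have hfu : ContinuousAt f (u + 0) := by
        simpa using hcont.continuousAt (Ici_mem_nhds hu.1)
      have h := hfu.tendsto.comp
        ((tendsto_one_div_add_atTop_nhds_zero_nat (𝕜 := ℝ)).const_add u)
      rw [add_zero] at h
      exact h.mul_const _
  exact ge_of_tendsto' hlim fun j => hshift _ (hε0 j)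

lemma image_sin_sq_Ioo : (fun θ : ℝ => sin θ ^ 2) '' Set.Ioo 0 (π / 2) = Set.Ioo 0 1 := by
  ext u
  constructor
  · rintro ⟨θ, hθ, rfl⟩
    have hs := sin_pos_of_pos_of_lt_pi hθ.1 (by linarith [hθ.2, pi_pos])
    have hc := cos_pos_of_mem_Ioo ⟨by linarith [hθ.1, pi_pos], hθ.2⟩
    exact ⟨by positivity, by nlinarith [sin_sq_add_cos_sq θ]⟩
  · rintro ⟨h0, h1⟩
    have hs0 : 0 < √u := sqrt_pos.2 h0
    have hs1 : √u < 1 := by rw [sqrt_lt' one_pos]; simpa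
    refine ⟨arcsin √u, ⟨arcsin_pos.2 hs0, arcsin_lt_pi_div_two.2 hs1⟩, ?_⟩
    dsimp only
    rw [sin_arcsin (by linarith) hs1.le, sq_sqrt h0.le]

lemma injOn_sin_sq : Set.InjOn (fun θ : ℝ => sin θ ^ 2) (Set.Ioo 0 (π / 2)) := by
  intro x hx y hy hxy
  have hsx := sin_pos_of_pos_of_lt_pi hx.1 (by linarith [hx.2, pi_pos])
  have hsy := sin_pos_of_pos_of_lt_pi hy.1 (by linarith [hy.2, pi_pos])
  exact injOn_sin ⟨by linarith [hx.1, pi_pos], hx.2.le⟩ ⟨by linarith [hy.1, pi_pos], hy.2.le⟩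
    ((pow_left_inj₀ hsx.le hsy.le two_ne_zero).1 hxy)

lemma integral_nuMeasure_sin_sq {α β : ℝ} (hα : -1 < α) (hβ : -1 < β) (h : ℝ → ℝ) :
    ∫ θ, h (sin θ ^ 2) ∂(nuMeasure α β) =
      Gamma (α + β + 2) / (Gamma (α + 1) * Gamma (β + 1)) *
        ∫ u in Set.Ioo (0 : ℝ) 1, h u * (u ^ α * (1 - u) ^ β) := by
  have hG1 : 0 < Gamma (α + 1) := Gamma_pos_of_pos (by linarith)
  have hG2 : 0 < Gamma (β + 1) := Gamma_pos_of_pos (by linarith)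
  have hG3 : 0 < Gamma (α + β + 2) := Gamma_pos_of_pos (by linarith)
  have hderiv : ∀ θ ∈ Set.Ioo 0 (π / 2),
      HasDerivWithinAt (fun θ : ℝ => sin θ ^ 2) (2 * sin θ * cos θ) (Set.Ioo 0 (π / 2)) θ :=
    fun θ _ => (((hasDerivAt_sin θ).fun_pow 2).congr_deriv (by simp)).hasDerivWithinAt
  rw [nuMeasure, integral_withDensity_eq_integral_toReal_smul (by fun_prop) (by simp),
    ← image_sin_sq_Ioo, integral_image_eq_integral_abs_deriv_smul measurableSet_Ioo hderiv
      injOn_sin_sq, ← integral_const_mul]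
  refine setIntegral_congr_fun measurableSet_Ioo fun θ hθ => ?_
  have hs : 0 < sin θ := sin_pos_of_pos_of_lt_pi hθ.1 (by linarith [hθ.2, pi_pos])
  have hc : 0 < cos θ := cos_pos_of_mem_Ioo ⟨by linarith [hθ.1, pi_pos], hθ.2⟩
  have hcos : 1 - sin θ ^ 2 = cos θ ^ 2 := by linarith [sin_sq_add_cos_sq θ]
  rw [ENNReal.toReal_ofReal (by positivity), abs_of_pos (by positivity), hcos,
    rpow_add hs, rpow_add hc, rpow_one, rpow_one, ← rpow_natCast (sin θ) 2,
    ← rpow_natCast (cos θ) 2, ← rpow_mul hs.le, ← rpow_mul hc.le, Nat.cast_ofNat,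
    smul_eq_mul, smul_eq_mul]
  ring

/-- If `f` is completely monotone on `[0,∞)`, then all Jacobi expansion coefficients of
`g` with `g(1−2u) = f(u)` are nonnegative. -/
theorem stmt9 (α β : ℝ) (hα : -1 < α) (hβ : -1 < β) (f : ℝ → ℝ)
    (hcont : ContinuousOn f (Set.Ici 0))
    (hsmooth : ContDiffOn ℝ (⊤ : ℕ∞) f (Set.Ioi 0))
    (hsign : ∀ (n : ℕ) (u : ℝ), 0 < u →
      0 ≤ (-1) ^ n * iteratedDerivWithin n f (Set.Ioi 0) u)
    (n : ℕ) :
    0 ≤ ∫ θ, f (Real.sin θ ^ 2) * jacobiP α β n (Real.cos (2 * θ)) ∂(nuMeasure α β) := by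
  have hcos : ∀ θ : ℝ, cos (2 * θ) = 1 - 2 * sin θ ^ 2 := fun θ => by
    rw [cos_two_mul, cos_sq']
    ring
  simp_rw [hcos]
  rw [integral_nuMeasure_sin_sq hα hβ fun u => f u * jacobiP α β n (1 - 2 * u)]
  have hG1 : 0 < Gamma (α + 1) := Gamma_pos_of_pos (by linarith)
  have hG2 : 0 < Gamma (β + 1) := Gamma_pos_of_pos (by linarith)
  have hG3 : 0 < Gamma (α + β + 2) := Gamma_pos_of_pos (by linarith)
  refine mul_nonneg (by positivity) ?_
  simpa only [jacobiWeighted, mul_assoc] using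
    integral_completelyMonotone_mul_jacobiWeighted_nonneg hα hβ hcont hsmooth hsign n
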